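/- (Closed form of the generating polynomial A_k.) For every positive integer k, the identity (1 − x²)(1 − x⁴)(1 − x^{2k}) · Σ_{i=1}^{3} Σ_{t=1}^{3k−2} Σ_{s=1}^{t} x^{−2ki+2t+2s+6k−4} = (1 − x^{6k−4})(1 − x^{6k−2})(1 − x^{6k}) holds in ℤ[x, x⁻¹]. (Here the left-hand triple sum is the normalized generating polynomial A_k(x) of the quantum data of the degree-4 product in direction (1,3) for the rank-2 quantum cluster scattering diagram with (δ₁, δ₂) = (3, 3k).) -/

import Mathlib

noncomputable section

/-- The monomial `x^n` (with `n ∈ ℤ`) in the ring `ℤ[x, x⁻¹]` of Laurent polynomials. -/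
def t (n : ℤ) : LaurentPolynomial ℤ := LaurentPolynomial.T n

theorem t_zero : t 0 = 1 := LaurentPolynomial.T_zero

theorem t_add (m n : ℤ) : t (m + n) = t m * t n := LaurentPolynomial.T_add m n

/-- The finite geometric sum in `x²`. -/
theorem one_sub_mul_sum_t (u : ℕ) :
    (1 - t 2) * ∑ s ∈ Finset.Icc 1 u, t (2 * (s : ℤ) - 2) = 1 - t (2 * (u : ℤ)) := by
  induction u with
  | zero => simp [t_zero]
  | succ n ih =>
    rw [Finset.sum_Icc_succ_top (by omega), mul_add, ih]
    have h₁ : 2 * ((n + 1 : ℕ) : ℤ) - 2 = 2 * (n : ℤ) := by push_cast; ring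
    have h₂ : 2 * ((n + 1 : ℕ) : ℤ) = 2 * (n : ℤ) + 2 := by push_cast; ring
    rw [h₁, h₂, t_add]
    ring

/-- The sum over weakly decreasing pairs is a Gaussian binomial coefficient in `x²`. -/
theorem one_sub_mul_sum_sum_t (N : ℕ) :
    (1 - t 2) * (1 - t 4) *
        ∑ u ∈ Finset.Icc 1 N, ∑ s ∈ Finset.Icc 1 u, t (2 * (u : ℤ) + 2 * (s : ℤ) - 4)
      = (1 - t (2 * (N : ℤ))) * (1 - t (2 * (N : ℤ) + 2)) := by
  induction N with
  | zero => simp [t_zero]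
  | succ n ih =>
    have inner : ∑ s ∈ Finset.Icc 1 (n + 1), t (2 * ((n + 1 : ℕ) : ℤ) + 2 * (s : ℤ) - 4)
        = t (2 * (n : ℤ)) * ∑ s ∈ Finset.Icc 1 (n + 1), t (2 * (s : ℤ) - 2) := by
      rw [Finset.mul_sum]
      refine Finset.sum_congr rfl fun s _ => ?_
      rw [← t_add]
      congr 1
      push_cast
      ring
    have geom := one_sub_mul_sum_t (n + 1)
    have h₂ : 2 * ((n + 1 : ℕ) : ℤ) = 2 * (n : ℤ) + 2 := by push_cast; ring
    have h₄ : t 4 = t 2 * t 2 := t_add 2 2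
    rw [Finset.sum_Icc_succ_top (by omega), mul_add, ih, inner]
    rw [h₂, t_add] at geom
    rw [h₂, t_add (2 * (n : ℤ) + 2), t_add (2 * (n : ℤ)), h₄]
    linear_combination (1 - t 2 * t 2) * t (2 * (n : ℤ)) * geom

/-- closed form of the generating polynomial `A_k`: for every positive
integer `k`, `(1 − x²)(1 − x⁴)(1 − x^{2k})·Σ_{i=1}^{3} Σ_{t=1}^{3k−2} Σ_{s=1}^{t}
x^{−2ki+2t+2s+6k−4} = (1 − x^{6k−4})(1 − x^{6k−2})(1 − x^{6k})`. -/
theorem generating_polynomial_Ak (k : ℕ) (hk : 0 < k) :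
    (1 - t 2) * (1 - t 4) * (1 - t (2 * (k : ℤ))) *
        ∑ i ∈ Finset.Icc 1 3, ∑ u ∈ Finset.Icc 1 (3 * k - 2), ∑ s ∈ Finset.Icc 1 u,
          t (-2 * (k : ℤ) * (i : ℤ) + 2 * (u : ℤ) + 2 * (s : ℤ) + 6 * (k : ℤ) - 4)
      = (1 - t (6 * (k : ℤ) - 4)) * ((1 - t (6 * (k : ℤ) - 2)) * (1 - t (6 * (k : ℤ)))) := by
  have split : ∀ i ∈ Finset.Icc 1 3,
      ∑ u ∈ Finset.Icc 1 (3 * k - 2), ∑ s ∈ Finset.Icc 1 u,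
          t (-2 * (k : ℤ) * (i : ℤ) + 2 * (u : ℤ) + 2 * (s : ℤ) + 6 * (k : ℤ) - 4)
        = t (2 * (k : ℤ) * (3 - (i : ℤ))) *
          ∑ u ∈ Finset.Icc 1 (3 * k - 2), ∑ s ∈ Finset.Icc 1 u,
            t (2 * (u : ℤ) + 2 * (s : ℤ) - 4) := by
    intro i _
    simp only [Finset.mul_sum, ← t_add]
    refine Finset.sum_congr rfl fun u _ => Finset.sum_congr rfl fun s _ => ?_
    congr 1
    ring
  have outer : (1 - t (2 * (k : ℤ))) * ∑ i ∈ Finset.Icc 1 3, t (2 * (k : ℤ) * (3 - (i : ℤ)))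
      = 1 - t (6 * (k : ℤ)) := by
    have hI : Finset.Icc 1 3 = ({1, 2, 3} : Finset ℤ) := by decide
    have e₁ : 2 * (k : ℤ) * (3 - 1) = 2 * k + 2 * k := by ring
    have e₂ : 2 * (k : ℤ) * (3 - 2) = 2 * k := by ring
    have e₃ : 2 * (k : ℤ) * (3 - 3) = 0 := by ring
    have e₆ : 6 * (k : ℤ) = 2 * k + 2 * k + 2 * k := by ring
    rw [hI, Finset.sum_insert (by decide), Finset.sum_insert (by decide), Finset.sum_singleton,
      e₁, e₂, e₃, e₆, t_zero, t_add (2 * (k : ℤ) + 2 * k), t_add (2 * (k : ℤ))]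
    ring
  have pairs := one_sub_mul_sum_sum_t (3 * k - 2)
  have hN : 2 * ((3 * k - 2 : ℕ) : ℤ) = 6 * (k : ℤ) - 4 := by omega
  have hN' : 6 * (k : ℤ) - 4 + 2 = 6 * (k : ℤ) - 2 := by ring
  rw [hN, hN'] at pairs
  rw [Finset.sum_congr rfl split, ← Finset.sum_mul, ← mul_assoc, ← mul_assoc,
    ← pairs, ← outer]
  ring
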